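/- arXiv:2203.06057 — 2 statements merged into one kernel-verified Lean document; each statement's English description precedes it below -/
import Mathlib

section
/- Let λ be a Lévy measure on (0,∞) satisfying Condition (F). Then 0 < τ̄(x) < ∞ for all x > 1, and for every c > 1, c^{−2/d} ≤ liminf_{x→∞} τ̄(cx)/τ̄(x) ≤ limsup_{x→∞} τ̄(cx)/τ̄(x) ≤ 1. In particular τ̄ has extended regular variation at infinity. -/
open MeasureTheory Real Filter Set
open scoped ENNReal Topology

noncomputable section

/-- The heat kernel on `ℝ^d` with diffusion constant `κ`. -/
def heatKernel (d : ℕ) (κ : ℝ) (s : ℝ) (x : EuclideanSpace ℝ (Fin d)) : ℝ :=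
  (2 * π * κ * s) ^ (-(d : ℝ) / 2) * Real.exp (-‖x‖ ^ 2 / (2 * κ * s))

/-- A Lévy measure on `(0,∞)`: a nonzero Borel measure carried by `(0,∞)`
with `∫ min(1, z²) λ(dz) < ∞`. -/
def IsLevyMeasure (lam : Measure ℝ) : Prop :=
  lam ≠ 0 ∧ lam (Set.Iic 0) = 0 ∧
    ∫⁻ z in Set.Ioi (0 : ℝ), ENNReal.ofReal (min 1 (z ^ 2)) ∂lam < ⊤

/-- `η̄(r) = (Leb ⊗ Leb ⊗ λ)({(s,y,z) ∈ (0,t] × ℝ^d × (0,∞) : g(s,y) z > r})`. -/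
def etaBar (d : ℕ) (κ t : ℝ) (lam : Measure ℝ) (r : ℝ) : ℝ≥0∞ :=
  (volume.prod (volume.prod lam))
    {p : ℝ × (EuclideanSpace ℝ (Fin d)) × ℝ |
      p.1 ∈ Set.Ioc (0 : ℝ) t ∧ p.2.2 ∈ Set.Ioi (0 : ℝ) ∧
        r < heatKernel d κ p.1 p.2.1 * p.2.2}

/-- `η̄₀(r)`, the analogue of `η̄` with the restriction `|y| ≤ 1/2`. -/
def etaBar0 (d : ℕ) (κ t : ℝ) (lam : Measure ℝ) (r : ℝ) : ℝ≥0∞ :=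
  (volume.prod (volume.prod lam))
    {p : ℝ × (EuclideanSpace ℝ (Fin d)) × ℝ |
      p.1 ∈ Set.Ioc (0 : ℝ) t ∧ p.2.2 ∈ Set.Ioi (0 : ℝ) ∧ ‖p.2.1‖ ≤ 1 / 2 ∧
        r < heatKernel d κ p.1 p.2.1 * p.2.2}

/-- `η̄_A(r)`, where the heat kernel is evaluated at `dist(y, A)`. -/
def etaBarA (d : ℕ) (κ t : ℝ) (lam : Measure ℝ)
    (A : Set (EuclideanSpace ℝ (Fin d))) (r : ℝ) : ℝ≥0∞ :=
  (volume.prod (volume.prod lam))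
    {p : ℝ × (EuclideanSpace ℝ (Fin d)) × ℝ |
      p.1 ∈ Set.Ioc (0 : ℝ) t ∧ p.2.2 ∈ Set.Ioi (0 : ℝ) ∧
        r < (2 * π * κ * p.1) ^ (-(d : ℝ) / 2) *
            Real.exp (-(Metric.infDist p.2.1 A) ^ 2 / (2 * κ * p.1)) * p.2.2}

/-- `τ̄(r) = (Leb ⊗ λ)({(s,z) ∈ (0,t] × (0,∞) : (2πκs)^{-d/2} z > r})`. -/
def tauBar (d : ℕ) (κ t : ℝ) (lam : Measure ℝ) (r : ℝ) : ℝ≥0∞ :=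
  (volume.prod lam)
    {p : ℝ × ℝ | p.1 ∈ Set.Ioc (0 : ℝ) t ∧ p.2 ∈ Set.Ioi (0 : ℝ) ∧
      r < (2 * π * κ * p.1) ^ (-(d : ℝ) / 2) * p.2}

/-- The truncated moment `M_γ(x) = ∫_{(0,x]} z^γ λ(dz)`. -/
def Mgamma (lam : Measure ℝ) (γ x : ℝ) : ℝ≥0∞ :=
  ∫⁻ z in Set.Ioc (0 : ℝ) x, ENNReal.ofReal (z ^ γ) ∂lam

/-- A measurable function, positive on `[1,∞)`, is slowly varying at infinity if
`ℓ(cx)/ℓ(x) → 1` as `x → ∞` for every `c > 0`. -/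
def SlowlyVarying (ℓ : ℝ → ℝ) : Prop :=
  Measurable ℓ ∧ (∀ x ≥ (1 : ℝ), 0 < ℓ x) ∧
    ∀ c > (0 : ℝ), Tendsto (fun x => ℓ (c * x) / ℓ x) atTop (𝓝 1)

/-- Regular variation at infinity with index `-α`: `f` is eventually positive and
`f(cr)/f(r) → c^{-α}` as `r → ∞` for every `c > 0`. -/
def RegVaryNeg (f : ℝ → ℝ) (α : ℝ) : Prop :=
  (∀ᶠ r in atTop, 0 < f r) ∧
    ∀ c > (0 : ℝ), Tendsto (fun r => f (c * r) / f r) atTop (𝓝 (c ^ (-α)))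

/-- Condition (E): the necessary and sufficient condition for existence of the solution. -/
def ConditionE (d : ℕ) (lam : Measure ℝ) : Prop :=
  (∫⁻ z in Set.Ioi (1 : ℝ), ENNReal.ofReal (Real.log z ^ ((d : ℝ) / 2)) ∂lam < ⊤) ∧
  (d = 1 → ∫⁻ z in Set.Ioc (0 : ℝ) 1, ENNReal.ofReal (z ^ 2) ∂lam < ⊤) ∧
  (d = 2 → ∫⁻ z in Set.Ioc (0 : ℝ) 1, ENNReal.ofReal (z ^ 2 * |Real.log z|) ∂lam < ⊤) ∧
  (3 ≤ d → ∫⁻ z in Set.Ioc (0 : ℝ) 1, ENNReal.ofReal (z ^ (1 + 2 / (d : ℝ))) ∂lam < ⊤)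

/-- Condition (F): `∫_{(0,1)} z^{2/d} λ(dz) < ∞` if `d ≠ 2`,
and `∫_{(0,1)} z |log z| λ(dz) < ∞` if `d = 2`. -/
def ConditionF (d : ℕ) (lam : Measure ℝ) : Prop :=
  (d ≠ 2 → ∫⁻ z in Set.Ioo (0 : ℝ) 1, ENNReal.ofReal (z ^ ((2 : ℝ) / d)) ∂lam < ⊤) ∧
  (d = 2 → ∫⁻ z in Set.Ioo (0 : ℝ) 1, ENNReal.ofReal (z * |Real.log z|) ∂lam < ⊤)

theorem IsLevyMeasure.measure_Ici_lt_top {lam : Measure ℝ} (hlam : IsLevyMeasure lam) {a : ℝ}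
    (ha : 0 < a) : lam (Ici a) < ⊤ := by
  have hm : 0 < min 1 (a ^ 2) := by positivity
  have h : ENNReal.ofReal (min 1 (a ^ 2)) * lam (Ici a) < ⊤ := by
    refine lt_of_le_of_lt ?_ hlam.2.2
    rw [← setLIntegral_const]
    refine (setLIntegral_mono' measurableSet_Ici fun z hz => ?_).trans
      (lintegral_mono_set (Ici_subset_Ioi.2 ha))
    exact ENNReal.ofReal_le_ofReal
      (min_le_min le_rfl (pow_le_pow_left₀ ha.le (mem_Ici.1 hz) 2))
  exact ENNReal.lt_top_of_mul_ne_top_right h.ne (ENNReal.ofReal_pos.2 hm).ne'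

theorem IsLevyMeasure.sigmaFinite {lam : Measure ℝ} (hlam : IsLevyMeasure lam) :
    SigmaFinite lam := by
  refine ⟨⟨⟨fun n : ℕ => Iic 0 ∪ Ici (1 / ((n : ℝ) + 1)), fun _ => trivial, fun n => ?_, ?_⟩⟩⟩
  · refine (measure_union_le _ _).trans_lt ?_
    rw [hlam.2.1, zero_add]
    exact hlam.measure_Ici_lt_top (by positivity)
  · refine eq_univ_of_forall fun z => mem_iUnion.2 ?_
    rcases le_or_gt z 0 with hz | hz
    · exact ⟨0, Or.inl hz⟩
    · obtain ⟨n, hn⟩ := exists_nat_one_div_lt hz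
      exact ⟨n, Or.inr hn.le⟩

theorem lt_rpow_neg_mul_iff {d : ℕ} (hd : 1 ≤ d) {k s z r : ℝ} (hk : 0 < k) (hs : 0 < s)
    (hz : 0 < z) (hr : 0 < r) :
    r < (k * s) ^ (-(d : ℝ) / 2) * z ↔ s < (z / r) ^ ((2 : ℝ) / d) / k := by
  have hd' : (0 : ℝ) < d := by exact_mod_cast hd
  have hks : 0 < k * s := by positivity
  have hpow : 0 < (k * s) ^ ((d : ℝ) / 2) := by positivity
  rw [neg_div, rpow_neg hks.le, inv_mul_eq_div, lt_div_iff₀ hpow, lt_div_iff₀' hk,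
    show (2 : ℝ) / d = ((d : ℝ) / 2)⁻¹ by rw [inv_div],
    lt_rpow_inv_iff_of_pos hks.le (by positivity) (by positivity), lt_div_iff₀' hr]

theorem volume_Ioc_inter_Iio (t b : ℝ) :
    volume (Ioc 0 t ∩ Iio b) = ENNReal.ofReal (min t b) := by
  apply le_antisymm
  · calc volume (Ioc 0 t ∩ Iio b) ≤ volume (Ioc 0 (min t b)) :=
          measure_mono fun s hs => ⟨hs.1.1, le_min hs.1.2 (le_of_lt hs.2)⟩
      _ = _ := by rw [Real.volume_Ioc, sub_zero]
  · calc ENNReal.ofReal (min t b) = volume (Ioo 0 (min t b)) := by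
          rw [Real.volume_Ioo, sub_zero]
      _ ≤ volume (Ioc 0 t ∩ Iio b) := measure_mono fun s hs =>
          ⟨⟨hs.1, (lt_min_iff.1 hs.2).1.le⟩, (lt_min_iff.1 hs.2).2⟩

theorem tauBar_eq_lintegral {d : ℕ} (hd : 1 ≤ d) {κ : ℝ} (t : ℝ) (hκ : 0 < κ)
    {lam : Measure ℝ} [SFinite lam] {r : ℝ} (hr : 0 < r) :
    tauBar d κ t lam r =
      ∫⁻ z in Ioi (0 : ℝ),
        ENNReal.ofReal (min t ((z / r) ^ ((2 : ℝ) / d) / (2 * π * κ))) ∂lam := by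
  have hms : MeasurableSet {p : ℝ × ℝ | p.1 ∈ Ioc (0 : ℝ) t ∧ p.2 ∈ Ioi (0 : ℝ) ∧
      r < (2 * π * κ * p.1) ^ (-(d : ℝ) / 2) * p.2} := by
    have hlt : MeasurableSet
        {p : ℝ × ℝ | r < (2 * π * κ * p.1) ^ (-(d : ℝ) / 2) * p.2} :=
      measurableSet_lt measurable_const
        (((measurable_const.mul measurable_fst).pow_const _).mul measurable_snd)
    exact (measurable_fst measurableSet_Ioc).inter ((measurable_snd measurableSet_Ioi).inter hlt)
  rw [tauBar, Measure.prod_apply_symm hms, ← lintegral_indicator measurableSet_Ioi]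
  refine lintegral_congr fun z => ?_
  by_cases hz : 0 < z
  · rw [indicator_of_mem (mem_Ioi.2 hz), ← volume_Ioc_inter_Iio]
    congr 1
    ext s
    simp only [mem_preimage, mem_ofPred_eq, mem_inter_iff, mem_Iio, mem_Ioi]
    refine and_congr_right fun hs => ?_
    rw [lt_rpow_neg_mul_iff hd (by positivity) hs.1 hz hr]
    simp [hz]
  · rw [indicator_of_notMem (by simpa using hz)]
    convert measure_empty (μ := (volume : Measure ℝ))
    ext s
    simp [hz]

theorem exists_lintegral_Ioo_rpow_lt_top {d : ℕ} {lam : Measure ℝ} (hF : ConditionF d lam) :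
    ∃ a > (0 : ℝ), ∫⁻ z in Ioo 0 a, ENNReal.ofReal (z ^ ((2 : ℝ) / d)) ∂lam < ⊤ := by
  by_cases h2 : d = 2
  · refine ⟨Real.exp (-1), Real.exp_pos _, lt_of_le_of_lt ?_ (hF.2 h2)⟩
    have hlt : Real.exp (-1) < 1 := Real.exp_lt_one_iff.2 (by norm_num)
    refine (setLIntegral_mono' measurableSet_Ioo fun z hz => ?_).trans
      (lintegral_mono_set (Ioo_subset_Ioo_right hlt.le))
    refine ENNReal.ofReal_le_ofReal ?_
    have hlog : Real.log z < -1 := (Real.log_lt_iff_lt_exp hz.1).2 hz.2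
    have : 1 ≤ |Real.log z| := by
      rw [abs_of_neg (by linarith)]
      linarith
    simpa [h2] using le_mul_of_one_le_right hz.1.le this
  · exact ⟨1, one_pos, hF.1 h2⟩

theorem tauBar_lt_top {d : ℕ} (hd : 1 ≤ d) {κ : ℝ} (t : ℝ) (hκ : 0 < κ) {lam : Measure ℝ}
    (hlam : IsLevyMeasure lam) (hF : ConditionF d lam) {r : ℝ} (hr : 0 < r) :
    tauBar d κ t lam r < ⊤ := by
  have := hlam.sigmaFinite
  obtain ⟨a, ha, hfin⟩ := exists_lintegral_Ioo_rpow_lt_top hF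
  rw [tauBar_eq_lintegral hd t hκ hr, ← Ioo_union_Ici_eq_Ioi ha]
  refine (lintegral_union_le _ _ _).trans_lt (ENNReal.add_lt_top.2 ⟨?_, ?_⟩)
  · have hK : 0 ≤ (r ^ ((2 : ℝ) / d) * (2 * π * κ))⁻¹ := by positivity
    calc _ ≤ ∫⁻ z in Ioo 0 a, ENNReal.ofReal (r ^ ((2 : ℝ) / d) * (2 * π * κ))⁻¹ *
            ENNReal.ofReal (z ^ ((2 : ℝ) / d)) ∂lam := by
          refine setLIntegral_mono' measurableSet_Ioo fun z hz => ?_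
          rw [← ENNReal.ofReal_mul hK]
          refine ENNReal.ofReal_le_ofReal ((min_le_right _ _).trans_eq ?_)
          rw [div_rpow hz.1.le hr.le, div_div, inv_mul_eq_div]
      _ < ⊤ := by
          rw [lintegral_const_mul' _ _ ENNReal.ofReal_ne_top]
          exact ENNReal.mul_lt_top ENNReal.ofReal_lt_top hfin
  · calc _ ≤ ∫⁻ _ in Ici a, ENNReal.ofReal t ∂lam :=
          lintegral_mono fun z => ENNReal.ofReal_le_ofReal (min_le_left _ _)
      _ < ⊤ := by
          rw [setLIntegral_const]
          exact ENNReal.mul_lt_top ENNReal.ofReal_lt_top (hlam.measure_Ici_lt_top ha)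

theorem tauBar_pos {d : ℕ} (hd : 1 ≤ d) {κ t : ℝ} (hκ : 0 < κ) (ht : 0 < t)
    {lam : Measure ℝ} (hlam : IsLevyMeasure lam) {r : ℝ} (hr : 0 < r) :
    0 < tauBar d κ t lam r := by
  have := hlam.sigmaFinite
  rw [tauBar_eq_lintegral hd t hκ hr, setLIntegral_pos_iff (by fun_prop)]
  have hpos : 0 < lam (Ioi 0) := by
    refine pos_iff_ne_zero.2 fun h => hlam.1 (Measure.measure_univ_eq_zero.1 ?_)
    rw [← Iic_union_Ioi (a := (0 : ℝ))]
    exact measure_union_null hlam.2.1 h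
  refine hpos.trans_le (measure_mono fun z hz => ⟨?_, hz⟩)
  have hz' : 0 < z := hz
  exact (ENNReal.ofReal_pos.2 (by positivity)).ne'

theorem tauBar_antitone (d : ℕ) (κ t : ℝ) (lam : Measure ℝ) : Antitone (tauBar d κ t lam) :=
  fun _ _ hrs => measure_mono fun _ hp => ⟨hp.1, hp.2.1, hrs.trans_lt hp.2.2⟩

theorem rpow_mul_tauBar_le {d : ℕ} (hd : 1 ≤ d) {κ t : ℝ} (hκ : 0 < κ) (ht : 0 < t)
    {lam : Measure ℝ} [SFinite lam] {c r : ℝ} (hc : 1 ≤ c) (hr : 0 < r) :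
    ENNReal.ofReal (c ^ (-((2 : ℝ) / d))) * tauBar d κ t lam r ≤ tauBar d κ t lam (c * r) := by
  have hc0 : 0 < c := by linarith
  have hq : 0 ≤ c ^ (-((2 : ℝ) / d)) := by positivity
  rw [tauBar_eq_lintegral hd t hκ hr, tauBar_eq_lintegral hd t hκ (by positivity),
    ← lintegral_const_mul' _ _ ENNReal.ofReal_ne_top]
  refine setLIntegral_mono' measurableSet_Ioi fun z hz => ?_
  have hz' : 0 < z := hz
  rw [← ENNReal.ofReal_mul hq, mul_min_of_nonneg _ _ hq]
  refine ENNReal.ofReal_le_ofReal (min_le_min ?_ (le_of_eq ?_))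
  · exact mul_le_of_le_one_left ht.le
      (rpow_le_one_of_one_le_of_nonpos hc (neg_nonpos.2 (by positivity)))
  · rw [mul_comm c r, ← div_div z, div_rpow (by positivity) hc0.le, rpow_neg hc0.le]
    ring

/-- Theorem 3.5 (i): under Condition (F), `0 < τ̄(x) < ∞` for `x > 1`, and for every
`c > 1`, `c^{-2/d} ≤ liminf τ̄(cx)/τ̄(x) ≤ limsup τ̄(cx)/τ̄(x) ≤ 1`;
in particular `τ̄` has extended regular variation. -/
theorem stmt_13 (d : ℕ) (hd : 1 ≤ d) (κ t : ℝ) (hκ : 0 < κ) (ht : 0 < t)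
    (lam : Measure ℝ) (hlam : IsLevyMeasure lam) (hF : ConditionF d lam) :
    (∀ x > (1 : ℝ), 0 < tauBar d κ t lam x ∧ tauBar d κ t lam x < ⊤) ∧
    ∀ c > (1 : ℝ),
      c ^ (-((2 : ℝ) / d)) ≤
        Filter.liminf (fun x : ℝ =>
          (tauBar d κ t lam (c * x)).toReal / (tauBar d κ t lam x).toReal) atTop ∧
      Filter.liminf (fun x : ℝ =>
          (tauBar d κ t lam (c * x)).toReal / (tauBar d κ t lam x).toReal) atTop ≤
        Filter.limsup (fun x : ℝ =>
          (tauBar d κ t lam (c * x)).toReal / (tauBar d κ t lam x).toReal) atTop ∧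
      Filter.limsup (fun x : ℝ =>
          (tauBar d κ t lam (c * x)).toReal / (tauBar d κ t lam x).toReal) atTop ≤ 1 := by
  have hsf := hlam.sigmaFinite
  refine ⟨fun x hx => ⟨tauBar_pos hd hκ ht hlam (by linarith),
    tauBar_lt_top hd t hκ hlam hF (by linarith)⟩, fun c hc => ?_⟩
  have hbounds : ∀ᶠ x : ℝ in atTop, c ^ (-((2 : ℝ) / d)) ≤
      (tauBar d κ t lam (c * x)).toReal / (tauBar d κ t lam x).toReal ∧
      (tauBar d κ t lam (c * x)).toReal / (tauBar d κ t lam x).toReal ≤ 1 := by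
    filter_upwards [eventually_gt_atTop 0] with x hx
    have hfin := (tauBar_lt_top hd t hκ hlam hF hx).ne
    have hcx : 0 < c * x := by positivity
    have hfinc := (tauBar_lt_top hd t hκ hlam hF hcx).ne
    have hpos := ENNReal.toReal_pos (tauBar_pos hd hκ ht hlam hx).ne' hfin
    constructor
    · rw [le_div_iff₀ hpos]
      have h := ENNReal.toReal_mono hfinc (rpow_mul_tauBar_le hd hκ ht (lam := lam) hc.le hx)
      rwa [ENNReal.toReal_mul, ENNReal.toReal_ofReal (by positivity)] at h
    · refine div_le_one_of_le₀ (ENNReal.toReal_mono hfin ?_) hpos.le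
      exact tauBar_antitone d κ t lam (le_mul_of_one_le_left hx.le hc.le)
  have hlow := hbounds.mono fun _ h => h.1
  have hup := hbounds.mono fun _ h => h.2
  have hba := isBoundedUnder_of_eventually_le hup
  have hbb := isBoundedUnder_of_eventually_ge hlow
  exact ⟨le_liminf_of_le hba.isCoboundedUnder_ge hlow, liminf_le_limsup hba hbb,
    limsup_le_of_le hbb.isCoboundedUnder_le hup⟩
end
end

section
/- Let λ be a Lévy measure on (0,∞) satisfying Condition (F). For every α ∈ [0, 2/d), the function τ̄ is regularly varying at infinity with index −α if and only if λ̄ is regularly varying at infinity with index −α. Moreover, τ̄ is regularly varying with index −2/d if and only if the function r ↦ ∫_0^r u^{2/d − 1} λ̄(u) du is slowly varying; in particular the latter holds if ∫_{(0,∞)} z^{2/d} λ(dz) < ∞ or if λ̄ is regularly varying with index −2/d. -/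
open MeasureTheory Real Filter Set
open scoped ENNReal Topology

noncomputable section

/-- The function `∫_0^r u^{p-1} g(u) du`. -/
def weightedPrimitive (p : ℝ) (g : ℝ → ℝ) (r : ℝ) : ℝ :=
  ∫ u in Set.Ioc (0 : ℝ) r, u ^ (p - 1) * g u

/-- A nonnegative nonincreasing function on `(0,∞)`, not identically zero, for which
`u^{p-1} g(u)` is integrable at the origin. -/
structure IsTail (p : ℝ) (g : ℝ → ℝ) : Prop where
  pos : 0 < p
  anti : ∀ x y, 0 < x → x ≤ y → g y ≤ g x
  nonneg : ∀ x, 0 ≤ g x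
  integrableOn : ∀ r, IntegrableOn (fun u => u ^ (p - 1) * g u) (Set.Ioc 0 r)
  exists_pos : ∃ x, 0 < x ∧ 0 < g x

namespace RegVaryNeg

theorem congr {f g : ℝ → ℝ} {α : ℝ} (hf : RegVaryNeg f α) (h : f =ᶠ[atTop] g) :
    RegVaryNeg g α := by
  refine ⟨?_, fun c hc => (hf.2 c hc).congr' ?_⟩
  · filter_upwards [hf.1, h] with r h1 h2 using h2 ▸ h1
  · filter_upwards [h, (tendsto_id.const_mul_atTop hc).eventually h] with r h1 h2
    simp only [id] at h2
    rw [h1, h2]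

theorem const_mul_rpow_mul_comp {f : ℝ → ℝ} {α : ℝ} (hf : RegVaryNeg f α) {K a : ℝ}
    (hK : 0 < K) (ha : 0 < a) (q : ℝ) :
    RegVaryNeg (fun r => K * r ^ q * f (a * r)) (α - q) := by
  have hlim : Tendsto (fun r : ℝ => a * r) atTop atTop := tendsto_id.const_mul_atTop ha
  refine ⟨?_, fun c hc => ?_⟩
  · filter_upwards [hlim.eventually hf.1, eventually_gt_atTop 0] with r h1 h2
    positivity
  · have h := ((hf.2 c hc).comp hlim).const_mul (c ^ q)
    rw [← Real.rpow_add hc, show q + -α = -(α - q) by ring] at h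
    refine h.congr' ?_
    filter_upwards [eventually_gt_atTop 0] with r hr
    have : r ^ q ≠ 0 := (Real.rpow_pos_of_pos hr q).ne'
    simp only [Function.comp]
    rw [Real.mul_rpow hc.le hr.le, show a * (c * r) = c * (a * r) by ring,
      mul_div_mul_comm, show K * (c ^ q * r ^ q) / (K * r ^ q) = c ^ q by field_simp]

theorem of_tendsto_pos {f : ℝ → ℝ} {l : ℝ} (hl : 0 < l) (hf : Tendsto f atTop (𝓝 l)) :
    RegVaryNeg f 0 := by
  refine ⟨hf.eventually_const_lt hl, fun c hc => ?_⟩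
  have h := (hf.comp (tendsto_id.const_mul_atTop hc)).div hf hl.ne'
  rw [div_self hl.ne'] at h
  rw [neg_zero, Real.rpow_zero]
  exact h

end RegVaryNeg

/-- A continuous analogue of the Stolz–Cesàro theorem. -/
theorem tendsto_integral_div_integral {a b : ℝ → ℝ} {L : ℝ}
    (ha : ∀ r, IntegrableOn a (Set.Ioc 0 r)) (hb : ∀ r, IntegrableOn b (Set.Ioc 0 r))
    (hpos : ∀ᶠ u in atTop, 0 < b u) (hab : Tendsto (fun u => a u / b u) atTop (𝓝 L))
    (htop : Tendsto (fun r => ∫ u in Set.Ioc (0 : ℝ) r, b u) atTop atTop) :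
    Tendsto (fun r => (∫ u in Set.Ioc (0 : ℝ) r, a u) / ∫ u in Set.Ioc (0 : ℝ) r, b u)
      atTop (𝓝 L) := by
  rw [Metric.tendsto_nhds]
  intro ε hε
  obtain ⟨X, hX⟩ := eventually_atTop.1
    ((Metric.tendsto_nhds.1 hab (ε / 2) (by positivity)).and (hpos.and (eventually_gt_atTop 0)))
  have hX0 : 0 < X := (hX X le_rfl).2.2
  set A := fun r => ∫ u in Set.Ioc (0 : ℝ) r, a u with hA
  set B := fun r => ∫ u in Set.Ioc (0 : ℝ) r, b u with hB
  have hsub : ∀ (f : ℝ → ℝ), (∀ r, IntegrableOn f (Set.Ioc 0 r)) → ∀ r, X ≤ r →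
      (∫ u in Set.Ioc (0 : ℝ) r, f u) =
        (∫ u in Set.Ioc (0 : ℝ) X, f u) + ∫ u in Set.Ioc X r, f u := by
    intro f hf r hr
    have hd : Disjoint (Set.Ioc 0 X) (Set.Ioc X r) :=
      Set.disjoint_left.2 fun x hx hy => absurd hx.2 (not_le.2 hy.1)
    rw [← Ioc_union_Ioc_eq_Ioc hX0.le hr, setIntegral_union hd measurableSet_Ioc (hf X)
      ((hf r).mono_set (Ioc_subset_Ioc_left hX0.le))]
  have key : ∀ r, X ≤ r → |A r - L * B r| ≤ |A X - L * B X| + ε / 2 * (B r - B X) := by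
    intro r hr
    have ha' := (ha r).mono_set (Ioc_subset_Ioc_left (b := r) hX0.le)
    have hb' := (hb r).mono_set (Ioc_subset_Ioc_left (b := r) hX0.le)
    have e1 : A r = A X + ∫ u in Set.Ioc X r, a u := hsub a ha r hr
    have e2 : B r = B X + ∫ u in Set.Ioc X r, b u := hsub b hb r hr
    have h3 : |∫ u in Set.Ioc X r, (a u - L * b u)| ≤ ∫ u in Set.Ioc X r, ε / 2 * b u := by
      rw [← Real.norm_eq_abs]
      refine norm_integral_le_of_norm_le (Integrable.const_mul hb' _) ?_
      refine (ae_restrict_mem measurableSet_Ioc).mono fun u hu => ?_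
      obtain ⟨h1, h2, -⟩ := hX u hu.1.le
      rw [Real.dist_eq] at h1
      have : a u - L * b u = (a u / b u - L) * b u := by field_simp
      rw [this, norm_mul, Real.norm_eq_abs, Real.norm_eq_abs, abs_of_pos h2]
      gcongr
    rw [integral_sub ha' (hb'.const_mul _), integral_const_mul, integral_const_mul] at h3
    calc |A r - L * B r| = |(A X - L * B X) +
          ((∫ u in Set.Ioc X r, a u) - L * ∫ u in Set.Ioc X r, b u)| := by
            rw [e1, e2]; ring_nf
      _ ≤ _ := (abs_add_le _ _).trans (by rw [e2]; linarith)
  filter_upwards [eventually_ge_atTop X, htop.eventually_gt_atTop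
    ((|A X - L * B X| + ε / 2 * |B X|) * (2 / ε)), htop.eventually_gt_atTop 0] with r h1 h2 h3
  change _ < B r at h2
  change 0 < B r at h3
  have h4 := key r h1
  have h5 : |A X - L * B X| + ε / 2 * |B X| < ε / 2 * B r := by
    have := mul_lt_mul_of_pos_left h2 (show 0 < ε / 2 by positivity)
    rwa [mul_comm (_ + _) (2 / ε), ← mul_assoc, show ε / 2 * (2 / ε) = 1 by field_simp,
      one_mul] at this
  rw [Real.dist_eq]
  change |A r / B r - L| < ε
  rw [show A r / B r - L = (A r - L * B r) / B r by field_simp, abs_div, abs_of_pos h3,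
    div_lt_iff₀ h3]
  have h6 := neg_abs_le (B X)
  nlinarith

theorem weightedPrimitive_mul_left (p : ℝ) (g : ℝ → ℝ) {c : ℝ} (hc : 0 < c) (r : ℝ) :
    weightedPrimitive p g (c * r) =
      c ^ p * ∫ u in Set.Ioc (0 : ℝ) r, u ^ (p - 1) * g (c * u) := by
  unfold weightedPrimitive
  rcases le_total r 0 with hr | hr
  · rw [Ioc_eq_empty (not_lt.2 hr),
      Ioc_eq_empty (not_lt.2 (mul_nonpos_of_nonneg_of_nonpos hc.le hr))]
    simp
  · rw [← intervalIntegral.integral_of_le (mul_nonneg hc.le hr),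
      ← intervalIntegral.integral_of_le hr]
    have e := intervalIntegral.smul_integral_comp_mul_left (a := 0) (b := r)
      (fun u => u ^ (p - 1) * g u) c
    rw [mul_zero] at e
    rw [← e, smul_eq_mul]
    have : ∫ u in (0 : ℝ)..r, (c * u) ^ (p - 1) * g (c * u) =
        ∫ u in (0 : ℝ)..r, c ^ (p - 1) * (u ^ (p - 1) * g (c * u)) := by
      refine intervalIntegral.integral_congr fun u hu => ?_
      rw [uIcc_of_le hr] at hu
      rw [Real.mul_rpow hc.le hu.1, mul_assoc]
    rw [this, intervalIntegral.integral_const_mul, ← mul_assoc]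
    congr 1
    rw [Real.rpow_sub_one hc.ne']
    field_simp

namespace IsTail

variable {p : ℝ} {g : ℝ → ℝ}

theorem intervalIntegrable (h : IsTail p g) {x y : ℝ} (hx : 0 ≤ x) (hxy : x ≤ y) :
    IntervalIntegrable (fun u => u ^ (p - 1) * g u) volume x y :=
  (intervalIntegrable_iff_integrableOn_Ioc_of_le hxy).2
    ((h.integrableOn y).mono_set (Ioc_subset_Ioc_left hx))

theorem sub_eq (h : IsTail p g) {x y : ℝ} (hx : 0 ≤ x) (hxy : x ≤ y) :
    weightedPrimitive p g y - weightedPrimitive p g x = ∫ u in x..y, u ^ (p - 1) * g u := by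
  unfold weightedPrimitive
  rw [← intervalIntegral.integral_of_le hx, ← intervalIntegral.integral_of_le (hx.trans hxy),
    ← intervalIntegral.integral_add_adjacent_intervals (h.intervalIntegrable le_rfl hx)
      (h.intervalIntegrable hx hxy)]
  ring

theorem integral_weight_mul_const (h : IsTail p g) (x y C : ℝ) :
    ∫ u in x..y, u ^ (p - 1) * C = C * ((y ^ p - x ^ p) / p) := by
  rw [intervalIntegral.integral_mul_const, integral_rpow (Or.inl (by linarith [h.pos]))]
  simp [mul_comm]

theorem le_sub (h : IsTail p g) {x y : ℝ} (hx : 0 ≤ x) (hxy : x ≤ y) :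
    g y * ((y ^ p - x ^ p) / p) ≤ weightedPrimitive p g y - weightedPrimitive p g x := by
  rw [h.sub_eq hx hxy, ← h.integral_weight_mul_const]
  refine intervalIntegral.integral_mono_on_of_le_Ioo hxy
    ((intervalIntegral.intervalIntegrable_rpow' (by linarith [h.pos])).mul_const _)
    (h.intervalIntegrable hx hxy) fun u hu => ?_
  have hu0 : 0 < u := hx.trans_lt hu.1
  have := h.anti u y hu0 hu.2.le
  gcongr

theorem sub_le (h : IsTail p g) {x y : ℝ} (hx : 0 < x) (hxy : x ≤ y) :
    weightedPrimitive p g y - weightedPrimitive p g x ≤ g x * ((y ^ p - x ^ p) / p) := by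
  rw [h.sub_eq hx.le hxy, ← h.integral_weight_mul_const]
  refine intervalIntegral.integral_mono_on_of_le_Ioo hxy (h.intervalIntegrable hx.le hxy)
    ((intervalIntegral.intervalIntegrable_rpow' (by linarith [h.pos])).mul_const _)
    fun u hu => ?_
  have hu0 : 0 < u := hx.trans hu.1
  have := h.anti x u hx hu.1.le
  gcongr

theorem weightedPrimitive_nonneg (h : IsTail p g) (r : ℝ) : 0 ≤ weightedPrimitive p g r :=
  setIntegral_nonneg measurableSet_Ioc fun u hu =>
    mul_nonneg (Real.rpow_nonneg hu.1.le _) (h.nonneg u)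

theorem monotone (h : IsTail p g) : Monotone (weightedPrimitive p g) := by
  intro x y hxy
  refine setIntegral_mono_set (h.integrableOn y) ?_ (Ioc_subset_Ioc_right hxy).eventuallyLE
  exact (ae_restrict_mem measurableSet_Ioc).mono fun u hu =>
    mul_nonneg (Real.rpow_nonneg hu.1.le _) (h.nonneg u)

theorem weightedPrimitive_pos (h : IsTail p g) {r : ℝ} (hr : 0 < r) :
    0 < weightedPrimitive p g r := by
  obtain ⟨x, hx, hgx⟩ := h.exists_pos
  have hm : 0 < min r x := lt_min hr hx
  have h1 := h.le_sub le_rfl hm.le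
  have h2 := h.anti _ _ hm (min_le_right r x)
  have h3 := h.monotone (min_le_left r x)
  have h4 : 0 < g (min r x) * ((min r x ^ p - 0 ^ p) / p) := by
    rw [Real.zero_rpow h.pos.ne', sub_zero]
    have := h.pos
    have : 0 < g (min r x) := hgx.trans_le h2
    positivity
  linarith [h.weightedPrimitive_nonneg 0]

theorem integrableOn_comp_mul_left (h : IsTail p g) {c : ℝ} (hc : 0 < c) (r : ℝ) :
    IntegrableOn (fun u => u ^ (p - 1) * g (c * u)) (Set.Ioc 0 r) := by
  rcases le_total r 0 with hr | hr
  · rw [Ioc_eq_empty (by simpa using hr)]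
    exact integrableOn_empty
  rw [← intervalIntegrable_iff_integrableOn_Ioc_of_le hr]
  have e := (h.intervalIntegrable le_rfl (mul_nonneg hc.le hr)).comp_mul_left (c := c)
  rw [zero_div, mul_div_cancel_left₀ _ hc.ne'] at e
  refine (e.const_mul ((c ^ (p - 1))⁻¹)).congr ?_
  refine fun u hu => ?_
  rw [uIoc_of_le hr] at hu
  have := (Real.rpow_pos_of_pos hc (p - 1)).ne'
  simp only
  rw [Real.mul_rpow hc.le hu.1.le]
  field_simp

/-- Karamata's theorem (direct half) when the primitive diverges. -/
theorem regVaryNeg_of_tendsto_atTop (h : IsTail p g) {α : ℝ} (hg : RegVaryNeg g α)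
    (htop : Tendsto (weightedPrimitive p g) atTop atTop) :
    RegVaryNeg (weightedPrimitive p g) (α - p) := by
  refine ⟨htop.eventually_gt_atTop 0, fun c hc => ?_⟩
  have key := tendsto_integral_div_integral (L := c ^ (-α))
    (h.integrableOn_comp_mul_left hc) h.integrableOn
    (by filter_upwards [hg.1, eventually_gt_atTop 0] with u h1 h2
        positivity)
    ((hg.2 c hc).congr' (by
      filter_upwards [eventually_gt_atTop 0] with u h2
      have := (Real.rpow_pos_of_pos h2 (p - 1)).ne'
      rw [mul_div_mul_left _ _ this])) htop
  have key2 := key.const_mul (c ^ p)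
  rw [← Real.rpow_add hc, show p + -α = -(α - p) by ring] at key2
  refine key2.congr fun r => ?_
  rw [weightedPrimitive_mul_left p g hc, mul_div_assoc]
  rfl

theorem tendsto_pos_of_not_atTop (h : IsTail p g)
    (hn : ¬ Tendsto (weightedPrimitive p g) atTop atTop) :
    ∃ l, 0 < l ∧ Tendsto (weightedPrimitive p g) atTop (𝓝 l) := by
  obtain h1 | ⟨l, hl⟩ := tendsto_atTop_of_monotone h.monotone
  · exact absurd h1 hn
  · exact ⟨l, (h.weightedPrimitive_pos one_pos).trans_le (h.monotone.ge_of_tendsto hl 1), hl⟩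

theorem tendsto_atTop_of_lt (h : IsTail p g) {α : ℝ} (hα : α < p) (hg : RegVaryNeg g α) :
    Tendsto (weightedPrimitive p g) atTop atTop := by
  by_contra hn
  obtain ⟨l, -, hl⟩ := h.tendsto_pos_of_not_atTop hn
  set T := weightedPrimitive p g with hT
  have h2p : (0 : ℝ) < 2 ^ p := by positivity
  obtain ⟨X, hX⟩ := eventually_atTop.1 ((((hg.2 2 two_pos).eventually_const_lt
    (show (2 : ℝ) ^ (-p) < 2 ^ (-α) by
      apply Real.rpow_lt_rpow_of_exponent_lt <;> linarith)).and hg.1).and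
      (eventually_gt_atTop 0))
  have hX0 : 0 < X := (hX X le_rfl).2
  have hstep : ∀ x, X ≤ x → T (2 * x) - T x ≤ T (2 * (2 * x)) - T (2 * x) := by
    intro x hx
    have hx0 : 0 < x := hX0.trans_le hx
    rw [h.sub_eq hx0.le (by linarith), h.sub_eq (by linarith) (by linarith)]
    have e := intervalIntegral.smul_integral_comp_mul_left (a := x) (b := 2 * x)
      (fun u => u ^ (p - 1) * g u) 2
    rw [← e, ← intervalIntegral.integral_smul]
    have hi := (h.intervalIntegrable (x := 2 * x) (y := 2 * (2 * x)) (by linarith)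
      (by linarith)).comp_mul_left (c := 2)
    rw [mul_div_cancel_left₀ _ (two_ne_zero), mul_div_cancel_left₀ _ (two_ne_zero)] at hi
    refine intervalIntegral.integral_mono_on (by linarith)
      (h.intervalIntegrable hx0.le (by linarith)) (hi.const_mul 2) fun u hu => ?_
    have hu0 : 0 < u := hx0.trans_le hu.1
    obtain ⟨⟨h1, h2⟩, -⟩ := hX u (hx.trans hu.1)
    rw [lt_div_iff₀ h2, Real.rpow_neg two_pos.le, inv_mul_lt_iff₀ h2p] at h1
    have h3 : (2 : ℝ) * ((2 * u) ^ (p - 1) * g (2 * u)) = u ^ (p - 1) * (2 ^ p * g (2 * u)) := by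
      rw [Real.mul_rpow two_pos.le hu0.le, Real.rpow_sub_one two_ne_zero]
      field_simp
    rw [smul_eq_mul, h3]
    gcongr
  have hiter : ∀ n : ℕ, T (2 * X) - T X ≤ T (2 * (2 ^ n * X)) - T (2 ^ n * X) := by
    intro n
    induction n with
    | zero => simp
    | succ n ih =>
      have h1 : (1 : ℝ) ≤ 2 ^ n := one_le_pow₀ one_le_two
      have := hstep (2 ^ n * X) (by nlinarith)
      rw [pow_succ, show (2 : ℝ) ^ n * 2 * X = 2 * (2 ^ n * X) by ring]
      exact ih.trans this
  have hseq : Tendsto (fun n : ℕ => (2 : ℝ) ^ n * X) atTop atTop :=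
    (tendsto_pow_atTop_atTop_of_one_lt one_lt_two).atTop_mul_const hX0
  have hlim := (hl.comp (hseq.const_mul_atTop two_pos)).sub (hl.comp hseq)
  rw [sub_self] at hlim
  have h1 : T (2 * X) - T X ≤ 0 := ge_of_tendsto' hlim hiter
  have h2 := h.le_sub hX0.le (show X ≤ 2 * X by linarith)
  have h3 : 0 < g (2 * X) := (hX (2 * X) (by linarith)).1.2
  have h4 : X ^ p < (2 * X) ^ p := Real.rpow_lt_rpow hX0.le (by linarith) h.pos
  have h5 : 0 < g (2 * X) * (((2 * X) ^ p - X ^ p) / p) :=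
    mul_pos h3 (div_pos (by linarith) h.pos)
  linarith

/-- The key limit in the monotone density theorem. -/
theorem tendsto_rpow_mul_div (h : IsTail p g) {ρ : ℝ}
    (hT : RegVaryNeg (weightedPrimitive p g) (-ρ)) :
    Tendsto (fun r => r ^ p * g r / weightedPrimitive p g r) atTop (𝓝 ρ) := by
  have hp := h.pos
  set T := weightedPrimitive p g with hTdef
  set H : ℝ → ℝ := fun c => (c ^ ρ - 1) * p / (c ^ p - 1) with hH
  have hlimH : Tendsto H (𝓝[≠] 1) (𝓝 ρ) := by
    have hder : ∀ q : ℝ, Tendsto (slope (fun c : ℝ => c ^ q) 1) (𝓝[≠] 1) (𝓝 q) := by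
      intro q
      have := Real.hasDerivAt_rpow_const (x := 1) (p := q) (Or.inl one_ne_zero)
      rw [hasDerivAt_iff_tendsto_slope] at this
      simpa using this
    have := ((hder ρ).mul_const p).div (hder p) hp.ne'
    rw [mul_div_cancel_right₀ _ hp.ne'] at this
    refine this.congr' ?_
    filter_upwards [self_mem_nhdsWithin] with c hc
    have hc' : c - 1 ≠ 0 := sub_ne_zero.2 hc
    simp only [Pi.div_apply, slope_def_field, Real.one_rpow, hH]
    rw [div_mul_eq_mul_div, div_div_div_cancel_right₀ hc']
  rw [tendsto_order]
  constructor
  · intro a ha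
    obtain ⟨c, hc, hc1⟩ := ((((hlimH.mono_left (nhdsGT_le_nhdsNE 1)).eventually_const_lt ha)).and
      (self_mem_nhdsWithin : Ioi (1 : ℝ) ∈ 𝓝[>] 1)).exists
    have hc1' : (1 : ℝ) < c := hc1
    have hcp : 0 < c ^ p - 1 := sub_pos.2 (Real.one_lt_rpow hc1' hp)
    have hc2 := hT.2 c (by linarith)
    rw [neg_neg] at hc2
    have h2 := ((hc2.sub_const 1).mul_const p).div_const (c ^ p - 1)
    filter_upwards [h2.eventually_const_lt hc, hT.1, eventually_gt_atTop 0] with r h3 h4 h5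
    refine h3.trans_le ?_
    have h6 := h.sub_le h5 (show r ≤ c * r by nlinarith)
    rw [Real.mul_rpow (by linarith) h5.le] at h6
    change T (c * r) - T r ≤ _ at h6
    rw [div_le_iff₀ hcp, show T (c * r) / T r - 1 = (T (c * r) - T r) / T r by field_simp,
      div_mul_eq_mul_div, div_mul_eq_mul_div]
    refine (div_le_div_iff_of_pos_right h4).2 ?_
    calc (T (c * r) - T r) * p ≤ g r * ((c ^ p * r ^ p - r ^ p) / p) * p := by gcongr
      _ = _ := by field_simp
  · intro a ha
    obtain ⟨c, hc, hc1, hc0⟩ := ((((hlimH.mono_left (nhdsLT_le_nhdsNE 1)).eventually_lt_const ha)).and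
      (Ioo_mem_nhdsLT (show (0 : ℝ) < 1 by norm_num))).exists
    have hcp : 0 < 1 - c ^ p := sub_pos.2 (Real.rpow_lt_one hc1.le hc0 hp)
    have hc2 := hT.2 c hc1
    rw [neg_neg] at hc2
    have h2 := ((hc2.sub_const 1).mul_const p).div_const (c ^ p - 1)
    filter_upwards [h2.eventually_lt_const hc, hT.1, eventually_gt_atTop 0] with r h3 h4 h5
    refine lt_of_le_of_lt ?_ h3
    have h6 := h.le_sub (mul_nonneg hc1.le h5.le) (show c * r ≤ r by nlinarith)
    rw [Real.mul_rpow hc1.le h5.le] at h6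
    change _ ≤ T r - T (c * r) at h6
    rw [show (T (c * r) / T r - 1) * p / (c ^ p - 1) =
      ((T r - T (c * r)) * p / (1 - c ^ p)) / T r by
        have : c ^ p - 1 ≠ 0 := by linarith
        have : 1 - c ^ p ≠ 0 := by linarith
        field_simp; ring]
    refine (div_le_div_iff_of_pos_right h4).2 ?_
    rw [le_div_iff₀ hcp]
    calc r ^ p * g r * (1 - c ^ p) = g r * ((r ^ p - c ^ p * r ^ p) / p) * p := by field_simp
      _ ≤ _ := by gcongr

/-- The monotone density theorem. -/
theorem regVaryNeg_of_weightedPrimitive (h : IsTail p g) {α : ℝ} (hα : α < p)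
    (hT : RegVaryNeg (weightedPrimitive p g) (α - p)) : RegVaryNeg g α := by
  have hlim := h.tendsto_rpow_mul_div (ρ := p - α) (by rwa [neg_sub])
  set T := weightedPrimitive p g with hTdef
  refine ⟨?_, fun c hc => ?_⟩
  · filter_upwards [hlim.eventually_const_lt (sub_pos.2 hα), hT.1, eventually_gt_atTop 0]
      with r h1 h2 h3
    rw [lt_div_iff₀ h2, zero_mul] at h1
    exact (pos_iff_pos_of_mul_pos h1).1 (Real.rpow_pos_of_pos h3 p)
  · have hl : Tendsto (fun r : ℝ => c * r) atTop atTop := tendsto_id.const_mul_atTop hc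
    have h1 := (((hlim.comp hl).div hlim (sub_pos.2 hα).ne').mul (hT.2 c hc)).mul_const
      (c ^ (-p))
    rw [div_self (sub_pos.2 hα).ne', one_mul, ← Real.rpow_add hc,
      show -(α - p) + -p = -α by ring] at h1
    refine h1.congr' ?_
    filter_upwards [hT.1, hl.eventually hT.1, eventually_gt_atTop 0] with r h2 h3 h4
    have h5 := (Real.rpow_pos_of_pos h4 p).ne'
    have h6 := (Real.rpow_pos_of_pos hc p).ne'
    simp only [Pi.div_apply, Function.comp]
    rw [Real.mul_rpow hc.le h4.le, Real.rpow_neg hc.le]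
    rw [div_mul_eq_mul_div, div_mul_eq_mul_div]
    field_simp

theorem regVaryNeg_weightedPrimitive_iff (h : IsTail p g) {α : ℝ} (hα : α < p) :
    RegVaryNeg (weightedPrimitive p g) (α - p) ↔ RegVaryNeg g α :=
  ⟨h.regVaryNeg_of_weightedPrimitive hα,
    fun hg => h.regVaryNeg_of_tendsto_atTop hg (h.tendsto_atTop_of_lt hα hg)⟩

theorem slowlyVarying_of_index_eq (h : IsTail p g) (hg : RegVaryNeg g p) :
    RegVaryNeg (weightedPrimitive p g) 0 := by
  by_cases htop : Tendsto (weightedPrimitive p g) atTop atTop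
  · simpa using h.regVaryNeg_of_tendsto_atTop hg htop
  · obtain ⟨l, hl, hT⟩ := h.tendsto_pos_of_not_atTop htop
    exact RegVaryNeg.of_tendsto_pos hl hT

theorem slowlyVarying_of_integrableOn (h : IsTail p g)
    (hi : IntegrableOn (fun u => u ^ (p - 1) * g u) (Set.Ioi 0)) :
    RegVaryNeg (weightedPrimitive p g) 0 := by
  refine RegVaryNeg.of_tendsto_pos (l := ∫ u in Set.Ioi (0 : ℝ), u ^ (p - 1) * g u) ?_ ?_
  · refine (h.weightedPrimitive_pos one_pos).trans_le
      (setIntegral_mono_set hi ?_ Ioc_subset_Ioi_self.eventuallyLE)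
    exact (ae_restrict_mem measurableSet_Ioi).mono fun u hu =>
      mul_nonneg (Real.rpow_nonneg (le_of_lt hu) _) (h.nonneg u)
  · refine (intervalIntegral_tendsto_integral_Ioi 0 hi tendsto_id).congr' ?_
    filter_upwards [eventually_ge_atTop 0] with r hr
    rw [id, intervalIntegral.integral_of_le hr, weightedPrimitive]

end IsTail

theorem tail_lt_top {lam : Measure ℝ} (h : IsLevyMeasure lam) {u : ℝ} (hu : 0 < u) :
    lam (Set.Ioi u) < ⊤ := by
  have hm : 0 < min 1 (u ^ 2) := by positivity
  have h1 := mul_meas_ge_le_lintegral₀ (μ := lam.restrict (Set.Ioi 0))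
    (f := fun z => ENNReal.ofReal (min 1 (z ^ 2))) (by fun_prop)
    (ENNReal.ofReal (min 1 (u ^ 2)))
  have h2 : lam (Set.Ioi u) ≤ lam.restrict (Set.Ioi 0)
      {z | ENNReal.ofReal (min 1 (u ^ 2)) ≤ ENNReal.ofReal (min 1 (z ^ 2))} := by
    rw [← Measure.restrict_eq_self lam (Set.Ioi_subset_Ioi hu.le)]
    refine measure_mono fun z (hz : u < z) => ?_
    change _ ≤ ENNReal.ofReal (min 1 (z ^ 2))
    gcongr
  refine h2.trans_lt ?_
  by_contra hcon
  rw [not_lt, top_le_iff] at hcon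
  rw [hcon, ENNReal.mul_top (ENNReal.ofReal_pos.2 hm).ne'] at h1
  exact absurd (h1.trans_lt h.2.2) (lt_irrefl _)

theorem sigmaFinite_of_isLevyMeasure {lam : Measure ℝ} (h : IsLevyMeasure lam) :
    SigmaFinite lam := by
  refine ⟨⟨⟨fun n : ℕ => Set.Iic 0 ∪ Set.Ioi (1 / ((n : ℝ) + 1)), fun _ => trivial,
    fun n => ?_, ?_⟩⟩⟩
  · refine (measure_union_le _ _).trans_lt ?_
    rw [h.2.1, zero_add]
    exact tail_lt_top h Nat.one_div_pos_of_nat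
  · refine eq_univ_of_forall fun x => ?_
    rcases le_or_gt x 0 with hx | hx
    · exact mem_iUnion.2 ⟨0, Or.inl hx⟩
    · obtain ⟨n, hn⟩ := exists_nat_one_div_lt hx
      exact mem_iUnion.2 ⟨n, Or.inr hn⟩

theorem exists_tail_pos {lam : Measure ℝ} (h : IsLevyMeasure lam) :
    ∃ x, 0 < x ∧ 0 < (lam (Set.Ioi x)).toReal := by
  by_contra! hcon
  refine h.1 (Measure.measure_univ_eq_zero.1 ?_)
  have hz : ∀ n : ℕ, lam (Set.Ioi (1 / ((n : ℝ) + 1))) = 0 := fun n => by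
    have h1 := hcon _ (Nat.one_div_pos_of_nat (α := ℝ) (n := n))
    exact ((ENNReal.toReal_eq_zero_iff _).1 (le_antisymm h1 ENNReal.toReal_nonneg)).resolve_right
      (tail_lt_top h Nat.one_div_pos_of_nat).ne
  refine measure_mono_null (t := Set.Iic 0 ∪ ⋃ n : ℕ, Set.Ioi (1 / ((n : ℝ) + 1)))
    (fun x _ => ?_) (measure_union_null h.2.1 (measure_iUnion_null hz))
  rcases le_or_gt x 0 with hx | hx
  · exact Or.inl hx
  · obtain ⟨n, hn⟩ := exists_nat_one_div_lt hx
    exact Or.inr (mem_iUnion.2 ⟨n, hn⟩)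

theorem measurable_tail (lam : Measure ℝ) : Measurable fun u => lam (Set.Ioi u) :=
  Antitone.measurable fun _ _ h => measure_mono (Set.Ioi_subset_Ioi h)

/-- Integrability of `u^{p-1} λ̄(u)` on `S` follows from finiteness of the moment `∫ f^p dλ`. -/
theorem integrableOn_tail_of_moment {lam : Measure ℝ} {p : ℝ} (hp : 0 < p) {f : ℝ → ℝ}
    (hf0 : ∀ z, 0 ≤ f z) (hf : Measurable f) {S : Set ℝ} (hS : MeasurableSet S)
    (hS0 : S ⊆ Set.Ioi 0) (hfS : ∀ u ∈ S, ∀ z, u < z → u < f z)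
    (hfin : ∫⁻ z, ENNReal.ofReal (f z ^ p) ∂lam < ⊤) :
    IntegrableOn (fun u => u ^ (p - 1) * (lam (Set.Ioi u)).toReal) S := by
  rw [lintegral_rpow_eq_lintegral_meas_lt_mul lam (Eventually.of_forall hf0) hf.aemeasurable
    hp] at hfin
  have hfin' := ENNReal.lt_top_of_mul_ne_top_right hfin.ne (ENNReal.ofReal_pos.2 hp).ne'
  refine ⟨((measurable_id.pow_const _).mul
    (measurable_tail lam).ennreal_toReal).aestronglyMeasurable, ?_⟩
  refine lt_of_le_of_lt ?_ hfin'
  refine (setLIntegral_mono' hS fun u hu => ?_).trans (lintegral_mono_set hS0)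
  have hu0 : 0 < u := hS0 hu
  rw [enorm_mul, Real.enorm_of_nonneg (Real.rpow_nonneg hu0.le _),
    Real.enorm_of_nonneg ENNReal.toReal_nonneg, mul_comm]
  gcongr
  exact ENNReal.ofReal_toReal_le.trans (measure_mono fun z hz => hfS u hu z hz)

theorem lintegral_Ioo_lt_top {d : ℕ} {lam : Measure ℝ} (h : IsLevyMeasure lam)
    (hF : ConditionF d lam) :
    ∫⁻ z in Set.Ioo (0 : ℝ) 1, ENNReal.ofReal (z ^ ((2 : ℝ) / d)) ∂lam < ⊤ := by
  by_cases hd : d = 2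
  · have hb : ∀ z ∈ Set.Ioo (0 : ℝ) 1, ENNReal.ofReal (z ^ ((2 : ℝ) / d)) ≤
        ENNReal.ofReal (z * |Real.log z|) +
          (Set.Ioi (Real.exp (-1))).indicator (fun _ => 1) z := by
      intro z hz
      rw [hd, Nat.cast_ofNat, div_self two_ne_zero, Real.rpow_one]
      by_cases hz1 : z ∈ Set.Ioi (Real.exp (-1))
      · rw [indicator_of_mem hz1]
        refine le_trans ?_ le_add_self
        exact ENNReal.ofReal_le_one.2 hz.2.le
      · refine le_trans (ENNReal.ofReal_le_ofReal ?_) le_self_add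
        have h1 : Real.log z ≤ -1 := (Real.log_le_iff_le_exp hz.1).2 (not_lt.1 hz1)
        have h2 : 1 ≤ |Real.log z| := by
          rw [abs_of_nonpos (by linarith)]
          linarith
        exact le_mul_of_one_le_right hz.1.le h2
    refine (setLIntegral_mono' measurableSet_Ioo hb).trans_lt ?_
    rw [lintegral_add_right _ (measurable_const.indicator measurableSet_Ioi)]
    refine ENNReal.add_lt_top.2 ⟨hF.2 hd, ?_⟩
    rw [lintegral_indicator_const measurableSet_Ioi, one_mul]
    exact (Measure.restrict_apply_le _ _).trans_lt (tail_lt_top h (Real.exp_pos _))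
  · exact hF.1 hd

theorem isTail_of_isLevyMeasure {d : ℕ} (hd : 1 ≤ d) {lam : Measure ℝ} (h : IsLevyMeasure lam)
    (hF : ConditionF d lam) : IsTail ((2 : ℝ) / d) fun u => (lam (Set.Ioi u)).toReal := by
  have hp : (0 : ℝ) < 2 / d := by
    have : (0 : ℝ) < d := by exact_mod_cast hd
    positivity
  refine ⟨hp, fun x y hx hxy => ?_, fun _ => ENNReal.toReal_nonneg, fun r => ?_,
    exists_tail_pos h⟩
  · exact ENNReal.toReal_mono (tail_lt_top h hx).ne (measure_mono (Set.Ioi_subset_Ioi hxy))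
  set R : ℝ := max r 0 + 1 with hR
  have hrR : r < R := (le_max_left r 0).trans_lt (lt_add_one _)
  have hR1 : 1 ≤ R := by linarith [le_max_right r 0]
  refine integrableOn_tail_of_moment hp (f := fun z => max 0 (min z R))
    (fun z => le_max_left _ _) (by fun_prop) measurableSet_Ioc Ioc_subset_Ioi_self
    (fun u hu z hz => lt_max_of_lt_right (lt_min hz (hu.2.trans_lt hrR))) ?_
  have hb : ∀ z, ENNReal.ofReal ((max 0 (min z R)) ^ ((2 : ℝ) / d)) ≤
      (Set.Ioo (0 : ℝ) 1).indicator (fun z => ENNReal.ofReal (z ^ ((2 : ℝ) / d))) z +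
        (Set.Ioi (1 / 2 : ℝ)).indicator (fun _ => ENNReal.ofReal (R ^ ((2 : ℝ) / d))) z := by
    intro z
    rcases le_or_gt z 0 with hz | hz
    · rw [max_eq_left ((min_le_left z R).trans hz), Real.zero_rpow hp.ne', ENNReal.ofReal_zero]
      exact zero_le
    have e : max 0 (min z R) = min z R := max_eq_right (le_min hz.le (by linarith))
    rw [e]
    rcases lt_or_ge z 1 with hz1 | hz1
    · rw [indicator_of_mem (show z ∈ Set.Ioo (0 : ℝ) 1 from ⟨hz, hz1⟩),
        min_eq_left (by linarith)]
      exact le_self_add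
    · rw [indicator_of_mem (show z ∈ Set.Ioi (1 / 2 : ℝ) by
        rw [Set.mem_Ioi]; linarith)]
      refine le_trans (ENNReal.ofReal_le_ofReal ?_) le_add_self
      exact Real.rpow_le_rpow (le_min hz.le (by linarith)) (min_le_right _ _) hp.le
  refine (lintegral_mono hb).trans_lt ?_
  rw [lintegral_add_right _ (measurable_const.indicator measurableSet_Ioi),
    lintegral_indicator measurableSet_Ioo, lintegral_indicator_const measurableSet_Ioi]
  exact ENNReal.add_lt_top.2 ⟨lintegral_Ioo_lt_top h hF,
    ENNReal.mul_lt_top ENNReal.ofReal_lt_top (tail_lt_top h (by norm_num))⟩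

theorem integrableOn_tail_Ioi {lam : Measure ℝ} {p : ℝ} (hp : 0 < p)
    (hfin : ∫⁻ z in Set.Ioi (0 : ℝ), ENNReal.ofReal (z ^ p) ∂lam < ⊤) :
    IntegrableOn (fun u => u ^ (p - 1) * (lam (Set.Ioi u)).toReal) (Set.Ioi 0) := by
  refine integrableOn_tail_of_moment hp (f := fun z => max 0 z) (fun z => le_max_left _ _)
    (by fun_prop) measurableSet_Ioi subset_rfl (fun u _ z hz => lt_max_of_lt_right hz) ?_
  rw [← lintegral_indicator measurableSet_Ioi] at hfin
  refine (lintegral_mono fun z => ?_).trans_lt hfin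
  rcases le_or_gt z 0 with hz | hz
  · rw [max_eq_left hz, Real.zero_rpow hp.ne', ENNReal.ofReal_zero]
    exact zero_le
  · rw [indicator_of_mem (show z ∈ Set.Ioi (0 : ℝ) from hz), max_eq_right hz.le]

theorem weightedPrimitive_eq_integral_rpow {p : ℝ} (hp : 0 < p) (g : ℝ → ℝ) {k t r : ℝ}
    (hk : 0 < k) (ht : 0 < t) (hr : 0 < r) :
    p * weightedPrimitive p g ((k * t) ^ p⁻¹ * r) =
      k * r ^ p * ∫ s in Set.Ioc (0 : ℝ) t, g (r * (k * s) ^ p⁻¹) := by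
  set B : ℝ := (k * t) ^ p⁻¹ * r with hB
  have hB0 : 0 < B := by positivity
  have hrp : 0 < r ^ p := Real.rpow_pos_of_pos hr p
  have hBp : B ^ p = k * r ^ p * t := by
    rw [hB, Real.mul_rpow (by positivity) hr.le, ← Real.rpow_mul (by positivity),
      inv_mul_cancel₀ hp.ne', Real.rpow_one]
    ring
  have h1 := integral_comp_rpow_Ioi
    ((Set.Ioc 0 (B ^ p)).indicator fun y => g (y ^ p⁻¹)) hp.ne'
  have h2 : ∫ y in Set.Ioi 0, (Set.Ioc 0 (B ^ p)).indicator (fun y => g (y ^ p⁻¹)) y =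
      k * r ^ p * ∫ s in Set.Ioc (0 : ℝ) t, g (r * (k * s) ^ p⁻¹) := by
    rw [setIntegral_indicator measurableSet_Ioc, inter_eq_right.2 Ioc_subset_Ioi_self,
      ← intervalIntegral.integral_of_le (by positivity),
      ← intervalIntegral.integral_of_le ht.le, hBp]
    have e := intervalIntegral.smul_integral_comp_mul_left (a := 0) (b := t)
      (fun y => g (y ^ p⁻¹)) (k * r ^ p)
    rw [mul_zero] at e
    rw [← e, smul_eq_mul]
    congr 1
    refine intervalIntegral.integral_congr fun s hs => ?_
    rw [uIcc_of_le ht.le] at hs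
    have hs0 := hs.1
    have e2 : (k * r ^ p * s) ^ p⁻¹ = r * (k * s) ^ p⁻¹ := by
      rw [show k * r ^ p * s = r ^ p * (k * s) by ring,
        Real.mul_rpow hrp.le (by positivity), Real.rpow_rpow_inv hr.le hp.ne']
    change g ((k * r ^ p * s) ^ p⁻¹) = g (r * (k * s) ^ p⁻¹)
    rw [e2]
  rw [← h2, ← h1, weightedPrimitive, ← integral_const_mul,
    ← inter_eq_right.2 (Ioc_subset_Ioi_self : Set.Ioc 0 B ⊆ Set.Ioi 0),
    ← setIntegral_indicator measurableSet_Ioc]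
  refine setIntegral_congr_fun measurableSet_Ioi fun x (hx : 0 < x) => ?_
  have hiff : x ^ p ∈ Set.Ioc 0 (B ^ p) ↔ x ∈ Set.Ioc 0 B := by
    simp only [Set.mem_Ioc, Real.rpow_le_rpow_iff hx.le hB0.le hp, hx, Real.rpow_pos_of_pos hx]
  by_cases hxB : x ∈ Set.Ioc 0 B
  · rw [indicator_of_mem hxB]
    simp only [indicator_of_mem (hiff.2 hxB)]
    rw [Real.rpow_rpow_inv hx.le hp.ne', abs_of_pos hp, smul_eq_mul, mul_assoc]
  · rw [indicator_of_notMem hxB]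
    simp only [indicator_of_notMem (mt hiff.1 hxB), smul_zero]

theorem tauBar_toReal_eq_integral {d : ℕ} {κ t : ℝ} (hκ : 0 < κ) {lam : Measure ℝ}
    (h : IsLevyMeasure lam) {r : ℝ} (hr : 0 < r) :
    (tauBar d κ t lam r).toReal =
      ∫ s in Set.Ioc (0 : ℝ) t,
        (lam (Set.Ioi (r * (2 * π * κ * s) ^ ((2 : ℝ) / d)⁻¹))).toReal := by
  have := sigmaFinite_of_isLevyMeasure h
  have hpos : ∀ s ∈ Set.Ioc (0 : ℝ) t, 0 < 2 * π * κ * s := fun s hs => by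
    have := hs.1
    have := Real.pi_pos
    positivity
  have hmeas : MeasurableSet {p : ℝ × ℝ | p.1 ∈ Set.Ioc (0 : ℝ) t ∧ p.2 ∈ Set.Ioi (0 : ℝ) ∧
      r < (2 * π * κ * p.1) ^ (-(d : ℝ) / 2) * p.2} :=
    (measurable_fst measurableSet_Ioc).inter ((measurable_snd measurableSet_Ioi).inter
      (measurableSet_lt measurable_const
        (g := fun p : ℝ × ℝ => (2 * π * κ * p.1) ^ (-(d : ℝ) / 2) * p.2) (by fun_prop)))
  have hsec : ∀ s, lam (Prod.mk s ⁻¹' {p : ℝ × ℝ | p.1 ∈ Set.Ioc (0 : ℝ) t ∧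
      p.2 ∈ Set.Ioi (0 : ℝ) ∧ r < (2 * π * κ * p.1) ^ (-(d : ℝ) / 2) * p.2}) =
      (Set.Ioc (0 : ℝ) t).indicator
        (fun s => lam (Set.Ioi (r * (2 * π * κ * s) ^ ((2 : ℝ) / d)⁻¹))) s := by
    intro s
    by_cases hs : s ∈ Set.Ioc (0 : ℝ) t
    · rw [indicator_of_mem hs]
      congr 1
      ext z
      have h1 := Real.rpow_pos_of_pos (hpos s hs) ((d : ℝ) / 2)
      change (s ∈ Set.Ioc (0 : ℝ) t ∧ 0 < z ∧ r < (2 * π * κ * s) ^ (-(d : ℝ) / 2) * z) ↔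
        r * (2 * π * κ * s) ^ ((2 : ℝ) / d)⁻¹ < z
      rw [inv_div, neg_div, Real.rpow_neg (hpos s hs).le, inv_mul_eq_div, lt_div_iff₀ h1]
      exact ⟨fun h => h.2.2, fun h => ⟨hs, (by positivity : 0 ≤ r * _).trans_lt h, h⟩⟩
    · rw [indicator_of_notMem hs]
      refine measure_mono_null (t := ∅) (fun z hz => absurd hz.1 hs) measure_empty
  rw [tauBar, Measure.prod_apply hmeas, lintegral_congr hsec,
    lintegral_indicator measurableSet_Ioc, integral_toReal]
  · exact ((measurable_tail lam).comp
      (g := fun u => lam (Set.Ioi u)) (f := fun s : ℝ => r * (2 * π * κ * s) ^ ((2 : ℝ) / d)⁻¹)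
      (by fun_prop)).aemeasurable
  · refine (ae_restrict_mem measurableSet_Ioc).mono fun s hs => tail_lt_top h ?_
    exact mul_pos hr (Real.rpow_pos_of_pos (hpos s hs) _)

theorem regVaryNeg_tauBar_iff {d : ℕ} (hd : 1 ≤ d) {κ t : ℝ} (hκ : 0 < κ) (ht : 0 < t)
    {lam : Measure ℝ} (h : IsLevyMeasure lam) (α : ℝ) :
    RegVaryNeg (fun r => (tauBar d κ t lam r).toReal) α ↔
      RegVaryNeg (weightedPrimitive ((2 : ℝ) / d) fun u => (lam (Set.Ioi u)).toReal)
        (α - 2 / d) := by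
  set p : ℝ := 2 / d with hpd
  set g : ℝ → ℝ := fun u => (lam (Set.Ioi u)).toReal with hg
  have hp : 0 < p := by
    have : (0 : ℝ) < d := by exact_mod_cast hd
    positivity
  have hk : 0 < 2 * π * κ := by
    have := Real.pi_pos
    positivity
  set a : ℝ := (2 * π * κ * t) ^ p⁻¹ with ha_def
  have ha : 0 < a := by positivity
  have key : ∀ r, 0 < r → (tauBar d κ t lam r).toReal =
      p / (2 * π * κ) * r ^ (-p) * weightedPrimitive p g (a * r) := by
    intro r hr
    have h1 := weightedPrimitive_eq_integral_rpow hp g hk ht hr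
    rw [← tauBar_toReal_eq_integral hκ h hr] at h1
    have h2 := (Real.rpow_pos_of_pos hr p).ne'
    rw [Real.rpow_neg hr.le]
    field_simp
    linarith
  constructor
  · intro hτ
    have h1 := hτ.const_mul_rpow_mul_comp (K := (2 * π * κ) / p * a ^ (-p)) (a := a⁻¹)
      (by positivity) (by positivity) p
    refine h1.congr ?_
    filter_upwards [eventually_gt_atTop 0] with r hr
    have h2 := (Real.rpow_pos_of_pos hr p).ne'
    have h3 := (Real.rpow_pos_of_pos ha p).ne'
    rw [key _ (by positivity), mul_inv_cancel_left₀ ha.ne', Real.mul_rpow (by positivity) hr.le,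
      Real.inv_rpow ha.le, Real.rpow_neg ha.le, Real.rpow_neg hr.le]
    field_simp
  · intro hT
    have h1 := hT.const_mul_rpow_mul_comp (K := p / (2 * π * κ)) (by positivity) ha (-p)
    rw [show α - p - -p = α by ring] at h1
    refine h1.congr ?_
    filter_upwards [eventually_gt_atTop 0] with r hr
    rw [key r hr]

/-- Theorem 3.5 (iii): for `α ∈ [0, 2/d)`, `τ̄ ∈ RV_{-α}` iff `λ̄ ∈ RV_{-α}`;
and `τ̄ ∈ RV_{-2/d}` iff `r ↦ ∫_0^r u^{2/d-1} λ̄(u) du` is slowly varying, which holds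
in particular if `∫ z^{2/d} λ(dz) < ∞` or if `λ̄ ∈ RV_{-2/d}`. -/
theorem stmt_14 (d : ℕ) (hd : 1 ≤ d) (κ t : ℝ) (hκ : 0 < κ) (ht : 0 < t)
    (lam : Measure ℝ) (hlam : IsLevyMeasure lam) (hF : ConditionF d lam)
    (F : ℝ → ℝ)
    (hF' : ∀ r : ℝ, F r = ∫ u in Set.Ioc (0 : ℝ) r,
        u ^ ((2 : ℝ) / d - 1) * (lam (Set.Ioi u)).toReal) :
    (∀ α : ℝ, 0 ≤ α → α < 2 / (d : ℝ) →
      (RegVaryNeg (fun r => (tauBar d κ t lam r).toReal) α ↔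
        RegVaryNeg (fun r => (lam (Set.Ioi r)).toReal) α)) ∧
    (RegVaryNeg (fun r => (tauBar d κ t lam r).toReal) (2 / (d : ℝ)) ↔
      RegVaryNeg F 0) ∧
    ((∫⁻ z in Set.Ioi (0 : ℝ), ENNReal.ofReal (z ^ ((2 : ℝ) / d)) ∂lam < ⊤) ∨
        RegVaryNeg (fun r => (lam (Set.Ioi r)).toReal) (2 / (d : ℝ)) →
      RegVaryNeg F 0) := by
  have hT := isTail_of_isLevyMeasure hd hlam hF
  obtain rfl : F = weightedPrimitive ((2 : ℝ) / d) fun u => (lam (Set.Ioi u)).toReal :=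
    funext hF'
  refine ⟨fun α _ hα => ?_, ?_, ?_⟩
  · rw [regVaryNeg_tauBar_iff hd hκ ht hlam, hT.regVaryNeg_weightedPrimitive_iff hα]
  · rw [regVaryNeg_tauBar_iff hd hκ ht hlam, sub_self]
  · rintro (h | h)
    · exact hT.slowlyVarying_of_integrableOn (integrableOn_tail_Ioi hT.pos h)
    · exact hT.slowlyVarying_of_index_eq h
end
end
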